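/- Let Q be a logic and A ⊆ Q. Then com(A) = ⋁S(A), i.e., Takeuti's commutator com(A) = ⋁{E ∈ A^! : (P1 ∧ E) ∘ (P2 ∧ E) for all P1, P2 ∈ A} equals the supremum of the set of subcommutators S(A) = {E ∈ Z(A) : (P1 ∧ E) ∘ (P2 ∧ E) for all P1, P2 ∈ A}. -/

import Mathlib

/-- A *logic*: a complete orthomodular lattice. -/
class COL (Q : Type*) extends CompleteLattice Q where
  /-- orthocomplementation -/
  oc : Q → Q
  oc_antitone : ∀ {P R : Q}, P ≤ R → oc R ≤ oc P
  oc_oc : ∀ P : Q, oc (oc P) = P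
  sup_oc : ∀ P : Q, P ⊔ oc P = ⊤
  inf_oc : ∀ P : Q, P ⊓ oc P = ⊥
  orthomodular : ∀ {P R : Q}, P ≤ R → P ⊔ (oc P ⊓ R) = R

variable {Q : Type*} [COL Q]

/-- `P` commutes with `R`, written `P ∘ R` in the paper. -/
def COL.commutes (P R : Q) : Prop := P = (P ⊓ R) ⊔ (P ⊓ COL.oc R)

/-- The commutant `A^!` of a subset `A` of a logic. -/
def COL.commutant (A : Set Q) : Set Q := {P : Q | ∀ R ∈ A, COL.commutes P R}

/-- The sublogic `L(A) = A^!!` generated by `A`. -/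
def COL.Lgen (A : Set Q) : Set Q := COL.commutant (COL.commutant A)

/-- The center `Z(A) = A^! ∩ A^!!` of the sublogic generated by `A`. -/
def COL.Zcen (A : Set Q) : Set Q := COL.commutant A ∩ COL.Lgen A

/-- The set `S(A)` of subcommutators of `A`. -/
def COL.subcom (A : Set Q) : Set Q :=
  {E : Q | E ∈ COL.Zcen A ∧ ∀ P1 ∈ A, ∀ P2 ∈ A, COL.commutes (P1 ⊓ E) (P2 ⊓ E)}

/-- Takeuti's commutator `com(A)`. -/
def COL.com (A : Set Q) : Q :=
  sSup {E : Q | E ∈ COL.commutant A ∧ ∀ P1 ∈ A, ∀ P2 ∈ A, COL.commutes (P1 ⊓ E) (P2 ⊓ E)}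

namespace COL

theorem oc_le_comm {P R : Q} (h : oc P ≤ R) : oc R ≤ P := by
  simpa only [oc_oc] using oc_antitone h

theorem le_oc_comm {P R : Q} (h : P ≤ oc R) : R ≤ oc P := by
  simpa only [oc_oc] using oc_antitone h

theorem oc_inf_oc_le (P R : Q) : oc P ⊓ oc R ≤ oc (P ⊔ R) :=
  le_oc_comm (sup_le (le_oc_comm inf_le_left) (le_oc_comm inf_le_right))

theorem inf_sup_le_of_le_of_le_oc {P d e : Q} (hd : d ≤ P) (he : e ≤ oc P) :
    P ⊓ (d ⊔ e) ≤ d := by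
  have hX : d ≤ P ⊓ (d ⊔ e) := le_inf hd le_sup_left
  have h0 : oc d ⊓ (P ⊓ (d ⊔ e)) ≤ ⊥ := by
    rw [← inf_oc (d ⊔ e)]
    refine le_inf (inf_le_right.trans inf_le_right) (le_trans ?_ (oc_inf_oc_le d e))
    exact inf_le_inf_left _ (inf_le_left.trans (le_oc_comm he))
  rw [← orthomodular hX]
  exact sup_le le_rfl (h0.trans bot_le)

theorem commutes_iff_le {P R : Q} : commutes P R ↔ P ≤ (P ⊓ R) ⊔ (P ⊓ oc R) :=
  ⟨fun h => h.le, fun h => le_antisymm h (sup_le inf_le_left inf_le_left)⟩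

theorem commutes.oc_right {P R : Q} (h : commutes P R) : commutes P (oc R) := by
  rw [commutes_iff_le, oc_oc, sup_comm]
  exact h.le

/-- If `P` commutes with `R`, the relative complement of `P ⊓ R` in `P` lies below `R^⊥`. -/
theorem commutes.inf_oc_inf_le {P R : Q} (h : commutes P R) : P ⊓ oc (P ⊓ R) ≤ oc R := by
  have hd : P ⊓ oc R ≤ oc (P ⊓ R) :=
    le_oc_comm (inf_le_right.trans (le_oc_comm inf_le_right))
  have h1 : oc (P ⊓ R) ⊓ ((P ⊓ oc R) ⊔ (P ⊓ R)) ≤ P ⊓ oc R :=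
    inf_sup_le_of_le_of_le_oc hd (oc_oc (P ⊓ R)).ge
  refine le_trans (le_inf inf_le_right (inf_le_left.trans ?_)) (h1.trans inf_le_right)
  rw [sup_comm]
  exact h.le

theorem commutes.symm {P R : Q} (h : commutes P R) : commutes R P := by
  have h1 : R ⊓ oc (P ⊓ R) ≤ oc P := by
    have hP : P ≤ (P ⊓ R) ⊔ oc R := h.le.trans (sup_le_sup_left inf_le_right _)
    refine le_oc_comm (hP.trans (sup_le ?_ ?_))
    · exact le_oc_comm inf_le_right
    · exact oc_antitone inf_le_left
  rw [commutes_iff_le]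
  calc R = (P ⊓ R) ⊔ (oc (P ⊓ R) ⊓ R) := (orthomodular inf_le_right).symm
    _ ≤ (R ⊓ P) ⊔ (R ⊓ oc P) :=
      sup_le_sup (inf_comm P R).le (le_inf inf_le_right ((inf_comm _ _).le.trans h1))

theorem commutes.oc_left {P R : Q} (h : commutes P R) : commutes (oc P) R :=
  h.symm.oc_right.symm

theorem commutes_of_le {P R : Q} (h : P ≤ R) : commutes P R :=
  commutes_iff_le.2 ((le_inf le_rfl h).trans le_sup_left)

theorem commutes_sSup {S : Set Q} {R : Q} (h : ∀ P ∈ S, commutes P R) :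
    commutes (sSup S) R := by
  rw [commutes_iff_le]
  refine sSup_le fun P hP => (h P hP).le.trans ?_
  exact sup_le_sup (inf_le_inf_right _ (le_sSup hP)) (inf_le_inf_right _ (le_sSup hP))

theorem commutes_sInf {S : Set Q} {R : Q} (h : ∀ P ∈ S, commutes P R) :
    commutes (sInf S) R := by
  have hS : sInf S = oc (sSup (oc '' S)) := by
    refine le_antisymm (le_oc_comm (sSup_le ?_)) (le_sInf fun P hP => ?_)
    · rintro _ ⟨P, hP, rfl⟩
      exact oc_antitone (sInf_le hP)
    · exact oc_le_comm (le_sSup ⟨P, hP, rfl⟩)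
  rw [hS]
  refine (commutes_sSup ?_).oc_left
  rintro _ ⟨P, hP, rfl⟩
  exact (h P hP).oc_left

theorem commutes.sup_left {P P' R : Q} (h : commutes P R) (h' : commutes P' R) :
    commutes (P ⊔ P') R := by
  rw [← sSup_pair]
  exact commutes_sSup (by rintro _ (rfl | rfl) <;> assumption)

theorem commutes.inf_left {P P' R : Q} (h : commutes P R) (h' : commutes P' R) :
    commutes (P ⊓ P') R := by
  rw [← sInf_pair]
  exact commutes_sInf (by rintro _ (rfl | rfl) <;> assumption)

theorem inf_sup_le_of_commutes {F x y : Q} (hx : commutes x F) (hy : commutes y F) :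
    F ⊓ (x ⊔ y) ≤ (x ⊓ F) ⊔ (y ⊓ F) := by
  refine le_trans (inf_le_inf_left F ?_) (inf_sup_le_of_le_of_le_oc
    (sup_le inf_le_right inf_le_right)
    (sup_le (inf_le_right : x ⊓ oc F ≤ _) (inf_le_right : y ⊓ oc F ≤ _)))
  refine sup_le (hx.le.trans ?_) (hy.le.trans ?_)
  · exact sup_le_sup le_sup_left le_sup_left
  · exact sup_le_sup le_sup_right le_sup_right

/-- The commutator of two elements. -/
def commutator (P R : Q) : Q :=
  ((P ⊓ R) ⊔ (P ⊓ oc R)) ⊔ ((oc P ⊓ R) ⊔ (oc P ⊓ oc R))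

theorem inf_le_of_commutes_inf {P R E : Q} (hR : commutes E R)
    (h : commutes (P ⊓ E) (R ⊓ E)) : P ⊓ E ≤ (P ⊓ R) ⊔ (P ⊓ oc R) := by
  refine h.le.trans (sup_le_sup ?_ ?_)
  · exact inf_le_inf inf_le_left inf_le_left
  · refine le_inf (inf_le_left.trans inf_le_left) (le_trans ?_ hR.inf_oc_inf_le)
    rw [inf_comm E R]
    exact inf_le_inf_right _ inf_le_right

theorem le_commutator {P R E : Q} (hP : commutes E P) (hR : commutes E R)
    (h : commutes (P ⊓ E) (R ⊓ E)) : E ≤ commutator P R := by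
  have hoc : oc P ⊓ E = E ⊓ oc (P ⊓ E) := by
    refine le_antisymm (le_inf inf_le_right (inf_le_left.trans (oc_antitone inf_le_left)))
      (le_inf ?_ inf_le_left)
    rw [inf_comm P E]
    exact hP.inf_oc_inf_le
  have h' : commutes (oc P ⊓ E) (R ⊓ E) := by
    rw [hoc]
    exact (commutes_of_le inf_le_right).symm.inf_left h.oc_left
  refine hP.le.trans (sup_le_sup ?_ ?_)
  · rw [inf_comm]
    exact inf_le_of_commutes_inf hR h
  · rw [inf_comm]
    exact inf_le_of_commutes_inf hR h'

theorem commutes_inf_of_le_commutator {P R F : Q} (hP : commutes F P) (hR : commutes F R)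
    (h : F ≤ commutator P R) : commutes (P ⊓ F) (R ⊓ F) := by
  have h1 : P ⊓ F ≤ (P ⊓ R) ⊔ (P ⊓ oc R) :=
    (inf_le_inf_left P h).trans (inf_sup_le_of_le_of_le_oc (sup_le inf_le_left inf_le_left)
      (sup_le inf_le_left inf_le_left))
  rw [commutes_iff_le]
  refine le_trans (le_inf inf_le_right h1) ((inf_sup_le_of_commutes
    (hP.symm.inf_left hR.symm) (hP.symm.inf_left hR.symm.oc_left)).trans (sup_le_sup ?_ ?_))
  · exact le_inf (inf_le_inf_right _ inf_le_left) (inf_le_inf_right _ inf_le_right)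
  · exact le_inf (inf_le_inf_right _ inf_le_left)
      ((inf_le_left.trans inf_le_right).trans (oc_antitone inf_le_left))

theorem subset_Lgen (A : Set Q) : A ⊆ Lgen A := fun P hP _ hR => (hR P hP).symm

theorem sup_mem_commutant {B : Set Q} {P R : Q} (hP : P ∈ commutant B)
    (hR : R ∈ commutant B) : P ⊔ R ∈ commutant B :=
  fun X hX => (hP X hX).sup_left (hR X hX)

theorem inf_mem_commutant {B : Set Q} {P R : Q} (hP : P ∈ commutant B)
    (hR : R ∈ commutant B) : P ⊓ R ∈ commutant B :=
  fun X hX => (hP X hX).inf_left (hR X hX)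

theorem oc_mem_commutant {B : Set Q} {P : Q} (hP : P ∈ commutant B) : oc P ∈ commutant B :=
  fun X hX => (hP X hX).oc_left

theorem sInf_mem_commutant {B S : Set Q} (hS : S ⊆ commutant B) : sInf S ∈ commutant B :=
  fun X hX => commutes_sInf fun _ hP => hS hP X hX

theorem commutator_mem_commutant {B : Set Q} {P R : Q} (hP : P ∈ commutant B)
    (hR : R ∈ commutant B) : commutator P R ∈ commutant B :=
  sup_mem_commutant
    (sup_mem_commutant (inf_mem_commutant hP hR) (inf_mem_commutant hP (oc_mem_commutant hR)))
    (sup_mem_commutant (inf_mem_commutant (oc_mem_commutant hP) hR)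
      (inf_mem_commutant (oc_mem_commutant hP) (oc_mem_commutant hR)))

/-- The least element of `L(A)` above an element of `A^!` is central in `L(A)`. -/
theorem sInf_Lgen_mem_Zcen {A : Set Q} {E : Q} (hE : E ∈ commutant A) :
    sInf {X | X ∈ Lgen A ∧ E ≤ X} ∈ Zcen A := by
  have hL : sInf {X | X ∈ Lgen A ∧ E ≤ X} ∈ Lgen A := sInf_mem_commutant fun _ hX => hX.1
  have hle : E ≤ sInf {X | X ∈ Lgen A ∧ E ≤ X} := le_sInf fun _ hX => hX.2
  refine ⟨fun P hP => commutes_iff_le.2 (sInf_le ⟨?_, ?_⟩), hL⟩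
  · exact sup_mem_commutant (inf_mem_commutant hL (subset_Lgen A hP))
      (inf_mem_commutant hL (oc_mem_commutant (subset_Lgen A hP)))
  · exact (hE P hP).le.trans (sup_le_sup (inf_le_inf_right _ hle) (inf_le_inf_right _ hle))

end COL

/-- Theorem 2.5 (iv): `com(A) = ⋁ S(A)`. -/
theorem stmt4 (A : Set Q) : COL.com A = sSup (COL.subcom A) := by
  refine le_antisymm (sSup_le ?_) (sSup_le_sSup fun E hE => ⟨hE.1.1, hE.2⟩)
  rintro E ⟨hE, hcomm⟩
  have hZ := COL.sInf_Lgen_mem_Zcen hE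
  refine le_trans (le_sInf fun _ hX => hX.2) (le_sSup ⟨hZ, fun P hP R hR => ?_⟩)
  refine COL.commutes_inf_of_le_commutator (hZ.1 P hP) (hZ.1 R hR) (sInf_le ⟨?_, ?_⟩)
  · exact COL.commutator_mem_commutant (COL.subset_Lgen A hP) (COL.subset_Lgen A hR)
  · exact COL.le_commutator (hE P hP) (hE R hR) (hcomm P hP R hR)
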